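/- Let x be an index with 1 < x ≤ n and BWT[x] ≠ BWT[x-1], let c ∈ {BWT[x], BWT[x-1]}, and set ℓ := Candt_c(b(x), e(x)). Let m be the smallest index with m > ℓ and LCP[m] < w(ℓ) if such an index exists, and m := n+1 otherwise. Then (i) ℓ < m ≤ e(x); and (ii) for every index j' with ℓ < j' < m such that BWT[j'] = c and w(j') ≥ 0, it holds that w(j') ≤ w(ℓ) and, setting ℓ' := j' if w(j') = LCP[j'] and ℓ' := j'+1 otherwise, j' ≠ Candt_c(b(ℓ'), j'+1). -/

import Mathlib

open scoped Classical

/-- `seg T i len` is the string `T[i..i+len-1]`. -/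
def seg (T : ℕ → ℤ) (i len : ℕ) : List ℤ :=
  (List.range len).map fun k => T (i + k)

/-- `sfx T n p` is the suffix `T[p..n]` of a length-`n` text. -/
def sfx (T : ℕ → ℤ) (n p : ℕ) : List ℤ := seg T p (n + 1 - p)

/-- The reversed text: `Trev T n n = T n` and `Trev T n i = T (n - i)` for `i < n`. -/
def Trev (T : ℕ → ℤ) (n : ℕ) : ℕ → ℤ := fun i => if i = n then T n else T (n - i)

/-- Length of the longest common prefix of two strings. -/
def lcpLen : List ℤ → List ℤ → ℕ
  | a :: l₁, b :: l₂ => if a = b then lcpLen l₁ l₂ + 1 else 0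
  | _, _ => 0

/-- `s` occurs as a substring of `T[1..n]`. -/
def OccursIn (T : ℕ → ℤ) (n : ℕ) (s : List ℤ) : Prop :=
  ∃ i : ℕ, 1 ≤ i ∧ i + s.length ≤ n + 1 ∧ s = seg T i s.length

/-- `s` is a right-maximal substring of `T[1..n]` over the alphabet `{1,…,σ}`. -/
def RightMax (T : ℕ → ℤ) (n σ : ℕ) (s : List ℤ) : Prop :=
  ∃ a b : ℤ, a ≠ b ∧ 1 ≤ a ∧ a ≤ (σ : ℤ) ∧ 1 ≤ b ∧ b ≤ (σ : ℤ) ∧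
    OccursIn T n (s ++ [a]) ∧ OccursIn T n (s ++ [b])

/-- `X` is a suffixient set for `T[1..n]`. -/
def Suffixient (T : ℕ → ℤ) (n σ : ℕ) (X : Set ℕ) : Prop :=
  ∀ s : List ℤ, RightMax T n σ s → ∀ c : ℤ, 1 ≤ c → c ≤ (σ : ℤ) →
    OccursIn T n (s ++ [c]) → ∃ x ∈ X, (s ++ [c]) <:+ seg T 1 x

def StartRun (BWT : ℕ → ℤ) (x : ℕ) : Prop := 1 < x ∧ BWT x ≠ BWT (x - 1)

def EndRun (BWT : ℕ → ℤ) (n x : ℕ) : Prop := x < n ∧ BWT x ≠ BWT (x + 1)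

def RunBoundary (BWT : ℕ → ℤ) (n x : ℕ) : Prop := StartRun BWT x ∨ EndRun BWT n x

/-- `bIdx L x` : the largest index `y < x` with `L y < L x`, or `1` if none exists. -/
noncomputable def bIdx (L : ℕ → ℤ) (x : ℕ) : ℕ :=
  sSup {y : ℕ | (1 ≤ y ∧ y < x ∧ L y < L x) ∨ y = 1}

/-- `eIdx L n x` : the smallest index `y > x` with `L y < L x`, or `n+1` if none exists. -/
noncomputable def eIdx (L : ℕ → ℤ) (n x : ℕ) : ℕ :=
  sInf {y : ℕ | (x < y ∧ y ≤ n ∧ L y < L x) ∨ y = n + 1}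

/-- The maximal weight `w y` over indices `a ≤ y < a'` with `BWT y = c` and `w y ≥ 0`. -/
noncomputable def wMax (BWT w : ℕ → ℤ) (c : ℤ) (a a' : ℕ) : ℤ :=
  (sSup {m : ℕ | ∃ q : ℕ, a ≤ q ∧ q < a' ∧ BWT q = c ∧ 0 ≤ w q ∧ (m : ℤ) = w q} : ℕ)

/-- `Candt BWT w c a a'`: the smallest index `a ≤ p < a'` with `BWT p = c` whose weight
attains the maximum weight among such indices; `-1` if no index
`a ≤ y < a'` with `BWT y = c` and `w y ≥ 0` exists. -/
noncomputable def Candt (BWT w : ℕ → ℤ) (c : ℤ) (a a' : ℕ) : ℤ :=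
  if ∃ p : ℕ, a ≤ p ∧ p < a' ∧ BWT p = c ∧ 0 ≤ w p then
    ((sInf {p : ℕ | a ≤ p ∧ p < a' ∧ BWT p = c ∧ w p = wMax BWT w c a a'} : ℕ) : ℤ)
  else -1

def FullL (n : ℕ) (SA : ℕ → ℕ) (BWT LCP w : ℕ → ℤ) : Set ℕ :=
  { q | ∃ x : ℕ, 1 < x ∧ x ≤ n ∧ BWT x ≠ BWT (x - 1) ∧
      ∃ c : ℤ, (c = BWT x ∨ c = BWT (x - 1)) ∧
      ∃ p : ℕ, (p : ℤ) = Candt BWT w c (bIdx LCP x) (eIdx LCP n x) ∧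
        q = n - SA p + 1 }

/-- Basic assumptions on the text `T[1..n]` over alphabet `{1,…,σ}` with sentinel `dollar`. -/
structure TextSetup (n σ : ℕ) (T : ℕ → ℤ) (dollar : ℤ) : Prop where
  hn : 2 ≤ n
  hsigma : 2 ≤ σ
  hsigma_le : σ ≤ n
  hT : ∀ i, 1 ≤ i → i ≤ n → 1 ≤ T i ∧ T i ≤ (σ : ℤ)
  hTn : T n = dollar
  hTne : ∀ i, 1 ≤ i → i < n → T i ≠ dollar

/-- `SA[1..n]` is the suffix array of the reversed text. -/
structure SASetup (n σ : ℕ) (T : ℕ → ℤ) (dollar : ℤ) (SA : ℕ → ℕ)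
    extends TextSetup n σ T dollar : Prop where
  hSAmem : ∀ i, 1 ≤ i → i ≤ n → 1 ≤ SA i ∧ SA i ≤ n
  hSAinj : ∀ i j, 1 ≤ i → i ≤ n → 1 ≤ j → j ≤ n → SA i = SA j → i = j
  hSAsurj : ∀ p, 1 ≤ p → p ≤ n → ∃ i, 1 ≤ i ∧ i ≤ n ∧ SA i = p
  hSAord : ∀ i j, 1 ≤ i → i < j → j ≤ n →
    List.Lex (· < ·) (sfx (Trev T n) n (SA i)) (sfx (Trev T n) n (SA j))

/-- `LCP[1..n]` is the LCP array of the reversed text. -/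
structure LCPSetup (n σ : ℕ) (T : ℕ → ℤ) (dollar : ℤ) (SA : ℕ → ℕ) (LCP : ℕ → ℤ)
    extends SASetup n σ T dollar SA : Prop where
  hLCP1 : LCP 1 = -1
  hLCP : ∀ i, 1 < i → i ≤ n →
    LCP i = (lcpLen (sfx (Trev T n) n (SA (i - 1))) (sfx (Trev T n) n (SA i)) : ℤ)
  hLCPend : LCP (n + 1) = -1

/-- Additionally, `BWT[1..n]` is the BWT of the reversed text and `w` is the weight function. -/
structure FullSetup (n σ : ℕ) (T : ℕ → ℤ) (dollar : ℤ) (SA : ℕ → ℕ)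
    (BWT LCP w : ℕ → ℤ) extends LCPSetup n σ T dollar SA LCP : Prop where
  hBWT : ∀ i, 1 ≤ i → i ≤ n → BWT i = T (n - SA i + 1)
  hBWTend : BWT (n + 1) = -1
  hwNot : ∀ x, 1 ≤ x → x ≤ n → ¬ RunBoundary BWT n x → w x = -1
  hwRB : ∀ x, 1 ≤ x → x ≤ n → RunBoundary BWT n x →
    (∃ s : List ℤ, RightMax T n σ s ∧ s <:+ seg T 1 (n - SA x)) →
    IsGreatest {m : ℤ | ∃ s : List ℤ, RightMax T n σ s ∧ s <:+ seg T 1 (n - SA x) ∧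
      m = (s.length : ℤ)} (w x)

/-- `sIdx`: the minimum index `i ∈ [1..n]` such that `T[n-SA[ℓ]+1-w(ℓ)..n-SA[ℓ]]`
is a suffix of `T[1..n-SA[i]]`. -/
noncomputable def sIdx (T : ℕ → ℤ) (n : ℕ) (SA : ℕ → ℕ) (w : ℕ → ℤ) (l : ℕ) : ℕ :=
  sInf {i : ℕ | 1 ≤ i ∧ i ≤ n ∧
    seg T (n - SA l + 1 - (w l).toNat) (w l).toNat <:+ seg T 1 (n - SA i)}

/-- `tIdx`: the maximum such index. -/
noncomputable def tIdx (T : ℕ → ℤ) (n : ℕ) (SA : ℕ → ℕ) (w : ℕ → ℤ) (l : ℕ) : ℕ :=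
  sSup {i : ℕ | 1 ≤ i ∧ i ≤ n ∧
    seg T (n - SA l + 1 - (w l).toNat) (w l).toNat <:+ seg T 1 (n - SA i)}

/-- `pIdx c i`: the largest index `j < i` with `w j > -1` and `BWT j = c`, or `0`. -/
noncomputable def pIdx (BWT w : ℕ → ℤ) (c : ℤ) (i : ℕ) : ℕ :=
  sSup {j : ℕ | (1 ≤ j ∧ j < i ∧ -1 < w j ∧ BWT j = c) ∨ j = 0}

/-- `pW c i`: the weight of `pIdx c i`, or `-1` if no index as in `pIdx` exists. -/
noncomputable def pW (BWT w : ℕ → ℤ) (c : ℤ) (i : ℕ) : ℤ :=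
  if ∃ j : ℕ, 1 ≤ j ∧ j < i ∧ -1 < w j ∧ BWT j = c then w (pIdx BWT w c i) else -1

/-- `α` is colexicographically smaller than `β`. -/
def ColexLt (α β : List ℤ) : Prop :=
  (α ≠ β ∧ α <:+ β) ∨
  ∃ k : ℕ, 1 ≤ k ∧ k ≤ α.length ∧ k ≤ β.length ∧
    (∀ i, 1 ≤ i → i < k → α.getD (α.length - i) 0 = β.getD (β.length - i) 0) ∧
    α.getD (α.length - k) 0 < β.getD (β.length - k) 0

theorem length_seg (T : ℕ → ℤ) (i len : ℕ) : (seg T i len).length = len := by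
  simp [seg]

theorem seg_succ (T : ℕ → ℤ) (i len : ℕ) : seg T i (len + 1) = seg T i len ++ [T (i + len)] := by
  simp [seg, List.range_succ]

/-- A suffix of a prefix of the text occurs in the text. -/
theorem occursIn_of_suffix_seg {T : ℕ → ℤ} {n N : ℕ} {t : List ℤ} (hN : N ≤ n)
    (h : t <:+ seg T 1 N) : OccursIn T n t := by
  have hlen : t.length ≤ N := by simpa [length_seg] using h.length_le
  refine ⟨1 + (N - t.length), by omega, by omega, ?_⟩
  rw [List.suffix_iff_eq_drop, length_seg] at h
  apply List.ext_getElem (length_seg _ _ _).symm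
  intro k h₁ _
  rw [List.getElem_of_eq h]
  simp [seg, add_assoc]

/-- A suffix of the reversed text is a reversed prefix of the text followed by the sentinel. -/
theorem sfx_Trev (T : ℕ → ℤ) {n p : ℕ} (hp : p ≤ n) :
    sfx (Trev T n) n p = (seg T 1 (n - p)).reverse ++ [T n] := by
  apply List.ext_getElem
  · simp [sfx, length_seg]
    omega
  · intro k h₁ h₂
    simp only [sfx, length_seg] at h₁
    rw [List.getElem_append]
    split_ifs with hk
    · simp only [List.length_reverse, length_seg] at hk
      simp only [sfx, seg, Trev, List.getElem_map, List.getElem_range, List.getElem_reverse,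
        List.length_map, List.length_range]
      rw [if_neg (by omega)]
      congr 1
      omega
    · simp only [List.length_reverse, length_seg] at hk
      have hkn : p + k = n := by omega
      simp [sfx, seg, Trev, hkn]

/-- The longest common prefix of two distinct strings terminated by the same sentinel
does not contain the sentinel. -/
theorem exists_common_prefix {d : ℤ} (u v : List ℤ) (hu : d ∉ u) (hv : d ∉ v) (huv : u ≠ v) :
    ∃ s : List ℤ, s.length = lcpLen (u ++ [d]) (v ++ [d]) ∧ s <+: u ∧ s <+: v := by
  induction u generalizing v with
  | nil =>
    cases v with
    | nil => exact absurd rfl huv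
    | cons b v =>
      have hb : d ≠ b := fun h => hv (by simp [h])
      exact ⟨[], by simp [lcpLen, hb], List.nil_prefix, List.nil_prefix⟩
  | cons a u ih =>
    cases v with
    | nil =>
      have ha : a ≠ d := fun h => hu (by simp [h])
      exact ⟨[], by simp [lcpLen, ha], List.nil_prefix, List.nil_prefix⟩
    | cons b v =>
      by_cases hab : a = b
      · subst hab
        obtain ⟨s, hs, h₁, h₂⟩ := ih v (fun h => hu (List.mem_cons_of_mem _ h))
          (fun h => hv (List.mem_cons_of_mem _ h)) (fun h => huv (by rw [h]))
        refine ⟨a :: s, by simp [lcpLen, hs], ?_, ?_⟩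
        · simpa using h₁
        · simpa using h₂
      · exact ⟨[], by simp [lcpLen, hab], List.nil_prefix, List.nil_prefix⟩

section Setup

variable {n σ : ℕ} {T : ℕ → ℤ} {dollar : ℤ} {SA : ℕ → ℕ} {BWT LCP w : ℕ → ℤ}

theorem TextSetup.notMem_seg (h : TextSetup n σ T dollar) {N : ℕ} (hN : N < n) :
    T n ∉ seg T 1 N := by
  intro hmem
  simp only [seg, List.mem_map, List.mem_range] at hmem
  obtain ⟨k, hk, hkT⟩ := hmem
  exact h.hTne (1 + k) (by omega) (by omega) (hkT.trans h.hTn)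

/-- At adjacent positions with distinct BWT characters, the longest common prefix is the
reversal of a right-maximal substring of the text. -/
theorem FullSetup.exists_rightMax (h : FullSetup n σ T dollar SA BWT LCP w) {i : ℕ}
    (hi : 1 ≤ i) (hin : i + 1 ≤ n) (hne : BWT i ≠ BWT (i + 1)) :
    ∃ s : List ℤ, RightMax T n σ s ∧ s <:+ seg T 1 (n - SA i) ∧
      s <:+ seg T 1 (n - SA (i + 1)) ∧ (s.length : ℤ) = LCP (i + 1) := by
  have hp := h.hSAmem i hi (by omega)
  have hq := h.hSAmem (i + 1) (by omega) hin
  have hpq : SA i ≠ SA (i + 1) := fun he => by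
    have := h.hSAinj i (i + 1) hi (by omega) (by omega) hin he
    omega
  obtain ⟨s, hs, h₁, h₂⟩ := exists_common_prefix (d := T n) (seg T 1 (n - SA i)).reverse
    (seg T 1 (n - SA (i + 1))).reverse
    (by rw [List.mem_reverse]; exact h.toTextSetup.notMem_seg (by omega))
    (by rw [List.mem_reverse]; exact h.toTextSetup.notMem_seg (by omega))
    (fun he => by
      have := congrArg List.length he
      simp only [List.length_reverse, length_seg] at this
      omega)
  have hs₁ : s.reverse <:+ seg T 1 (n - SA i) := by simpa using List.reverse_suffix.2 h₁
  have hs₂ : s.reverse <:+ seg T 1 (n - SA (i + 1)) := by simpa using List.reverse_suffix.2 h₂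
  have key : ∀ j, 1 ≤ j → j ≤ n → s.reverse <:+ seg T 1 (n - SA j) →
      (1 ≤ BWT j ∧ BWT j ≤ (σ : ℤ)) ∧ OccursIn T n (s.reverse ++ [BWT j]) := by
    intro j hj hjn hsuf
    have hr := h.hSAmem j hj hjn
    rw [h.hBWT j hj hjn]
    refine ⟨h.hT _ (by omega) (by omega), ?_⟩
    apply occursIn_of_suffix_seg (N := n - SA j + 1) (by omega)
    rw [seg_succ, add_comm 1]
    obtain ⟨t, ht⟩ := hsuf
    exact ⟨t, by rw [← ht, List.append_assoc]⟩
  obtain ⟨⟨ha₁, ha₂⟩, hocc₁⟩ := key i hi (by omega) hs₁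
  obtain ⟨⟨hb₁, hb₂⟩, hocc₂⟩ := key (i + 1) (by omega) hin hs₂
  refine ⟨s.reverse, ⟨BWT i, BWT (i + 1), hne, ha₁, ha₂, hb₁, hb₂, hocc₁, hocc₂⟩, hs₁, hs₂, ?_⟩
  rw [h.hLCP (i + 1) (by omega) hin, Nat.add_sub_cancel, sfx_Trev T hp.2, sfx_Trev T hq.2,
    List.length_reverse, hs]

theorem FullSetup.length_le_weight (h : FullSetup n σ T dollar SA BWT LCP w) {i : ℕ}
    (hi : 1 ≤ i) (hin : i ≤ n) (hb : RunBoundary BWT n i) {s : List ℤ} (hs : RightMax T n σ s)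
    (hsuf : s <:+ seg T 1 (n - SA i)) : (s.length : ℤ) ≤ w i :=
  (h.hwRB i hi hin hb ⟨s, hs, hsuf⟩).2 ⟨s, hs, hsuf, rfl⟩

theorem FullSetup.weight_of_endRun (h : FullSetup n σ T dollar SA BWT LCP w) {i : ℕ}
    (hi : 1 ≤ i) (hin : i + 1 ≤ n) (hne : BWT i ≠ BWT (i + 1)) :
    0 ≤ w i ∧ LCP (i + 1) ≤ w i := by
  obtain ⟨s, hs, h₁, -, hlen⟩ := h.exists_rightMax hi hin hne
  have := h.length_le_weight hi (by omega) (Or.inr ⟨by omega, hne⟩) hs h₁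
  omega

theorem FullSetup.weight_of_startRun (h : FullSetup n σ T dollar SA BWT LCP w) {i : ℕ}
    (hi : 1 < i) (hin : i ≤ n) (hne : BWT i ≠ BWT (i - 1)) :
    0 ≤ w i ∧ LCP i ≤ w i := by
  obtain ⟨i, rfl⟩ : ∃ k, i = k + 1 := ⟨i - 1, by omega⟩
  rw [Nat.add_sub_cancel] at hne
  obtain ⟨s, hs, -, h₂, hlen⟩ := h.exists_rightMax (by omega) hin hne.symm
  have := h.length_le_weight (by omega) hin (Or.inl ⟨hi, by simpa using hne⟩) hs h₂
  omega

end Setup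

/-- The defining properties of `Candt` when it is a genuine index. -/
theorem Candt_spec {BWT w : ℕ → ℤ} {c : ℤ} {a a' p : ℕ} (hp : (p : ℤ) = Candt BWT w c a a') :
    a ≤ p ∧ p < a' ∧ BWT p = c ∧
      (∀ q, a ≤ q → q < a' → BWT q = c → 0 ≤ w q → w q ≤ w p) ∧
      (∀ q, a ≤ q → q < p → BWT q = c → w q < w p ∨ w q < 0) := by
  unfold Candt at hp
  split_ifs at hp with hex
  · set S := {m : ℕ | ∃ q : ℕ, a ≤ q ∧ q < a' ∧ BWT q = c ∧ 0 ≤ w q ∧ (m : ℤ) = w q} with hS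
    have hfin : S.Finite := by
      refine ((Set.finite_Iio a').image fun q => (w q).toNat).subset ?_
      rintro k ⟨q, -, hq, -, -, hk⟩
      exact ⟨q, hq, by simp [← hk]⟩
    have hne : S.Nonempty := by
      obtain ⟨q, h₁, h₂, h₃, h₄⟩ := hex
      exact ⟨(w q).toNat, q, h₁, h₂, h₃, h₄, Int.toNat_of_nonneg h₄⟩
    have hmax : ∀ q, a ≤ q → q < a' → BWT q = c → 0 ≤ w q → w q ≤ wMax BWT w c a a' := by
      intro q h₁ h₂ h₃ h₄
      have := le_csSup hfin.bddAbove
        (show (w q).toNat ∈ S from ⟨q, h₁, h₂, h₃, h₄, Int.toNat_of_nonneg h₄⟩)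
      rw [wMax, ← hS]
      omega
    have hmem := Nat.sSup_mem hne hfin.bddAbove
    obtain ⟨q, h₁, h₂, h₃, -, h₅⟩ := hmem
    have hpS := Nat.sInf_mem (s := {p | a ≤ p ∧ p < a' ∧ BWT p = c ∧ w p = wMax BWT w c a a'})
      ⟨q, h₁, h₂, h₃, h₅.symm⟩
    have hp' := Nat.cast_injective hp
    rw [← hp'] at hpS
    obtain ⟨g₁, g₂, g₃, g₄⟩ := hpS
    refine ⟨g₁, g₂, g₃, fun r k₁ k₂ k₃ k₄ => g₄ ▸ hmax r k₁ k₂ k₃ k₄, fun r k₁ k₂ k₃ => ?_⟩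
    by_contra! hcon
    have hle := hmax r k₁ (by omega) k₃ hcon.2
    have : p ≤ r := hp' ▸ Nat.sInf_le ⟨k₁, by omega, k₃, by omega⟩
    omega

theorem bIdx_le {L : ℕ → ℤ} {x k : ℕ} (hk : 1 ≤ k) (h : ∀ y, k < y → y < x → L x ≤ L y) :
    bIdx L x ≤ k := by
  refine csSup_le' ?_
  rintro y (⟨-, hy, hL⟩ | rfl)
  · by_contra! hky
    exact absurd (h y hky hy) (by omega)
  · exact hk

theorem one_le_bIdx (L : ℕ → ℤ) (x : ℕ) : 1 ≤ bIdx L x := by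
  refine le_csSup ⟨x + 1, ?_⟩ (Or.inr rfl)
  rintro y (⟨-, hy, -⟩ | rfl) <;> omega

theorem eIdx_spec (L : ℕ → ℤ) (n x : ℕ) :
    (x < eIdx L n x ∧ eIdx L n x ≤ n ∧ L (eIdx L n x) < L x) ∨ eIdx L n x = n + 1 :=
  Nat.sInf_mem (s := {y : ℕ | (x < y ∧ y ≤ n ∧ L y < L x) ∨ y = n + 1}) ⟨n + 1, Or.inr rfl⟩

/-- Let `x` with `1 < x ≤ n` and `BWT[x] ≠ BWT[x-1]`, `c ∈ {BWT[x], BWT[x-1]}`,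
`ℓ := Candt_c(b(x), e(x))`, and let `m` be the smallest index `m > ℓ` with `LCP[m] < w(ℓ)` if
it exists and `m := n+1` otherwise. Then (i) `ℓ < m ≤ e(x)`; and (ii) for every `ℓ < j' < m`
with `BWT[j'] = c` and `w(j') ≥ 0`, it holds that `w(j') ≤ w(ℓ)` and, setting `ℓ' := j'` if
`w(j') = LCP[j']` and `ℓ' := j'+1` otherwise, `j' ≠ Candt_c(b(ℓ'), j'+1)`. -/
theorem stmt11 (n σ : ℕ) (T : ℕ → ℤ) (dollar : ℤ) (SA : ℕ → ℕ) (BWT LCP w : ℕ → ℤ)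
    (hsetup : FullSetup n σ T dollar SA BWT LCP w)
    (x : ℕ) (hx1 : 1 < x) (hxn : x ≤ n) (hrun : BWT x ≠ BWT (x - 1))
    (c : ℤ) (hc : c = BWT x ∨ c = BWT (x - 1))
    (l : ℕ) (hl : (l : ℤ) = Candt BWT w c (bIdx LCP x) (eIdx LCP n x))
    (m : ℕ)
    (hm : (l < m ∧ m ≤ n ∧ LCP m < w l ∧ ∀ j, l < j → j < m → ¬ LCP j < w l) ∨
      (m = n + 1 ∧ ∀ j, l < j → j ≤ n → ¬ LCP j < w l)) :
    (l < m ∧ m ≤ eIdx LCP n x) ∧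
      ∀ j' : ℕ, l < j' → j' < m → BWT j' = c → 0 ≤ w j' →
        w j' ≤ w l ∧
          ∀ l' : ℕ, l' = (if w j' = LCP j' then j' else j' + 1) →
            (j' : ℤ) ≠ Candt BWT w c (bIdx LCP l') (j' + 1) := by
  have hb₁ := one_le_bIdx LCP x
  have hbx : bIdx LCP x ≤ x - 1 := bIdx_le (by omega) fun y _ _ => by omega
  have he := eIdx_spec LCP n x
  have hen : eIdx LCP n x ≤ n + 1 := by omega
  obtain ⟨hbl, hle, hlc, hlmax, -⟩ := Candt_spec hl
  have hxw : LCP x ≤ w l := by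
    rcases hc with rfl | rfl
    · obtain ⟨h0, hL⟩ := hsetup.weight_of_startRun hx1 hxn hrun
      exact hL.trans (hlmax x (by omega) (by omega) rfl h0)
    · have hx : x - 1 + 1 = x := by omega
      obtain ⟨h0, hL⟩ := hsetup.weight_of_endRun (i := x - 1) (by omega) (by omega)
        (by rw [hx]; exact hrun.symm)
      rw [hx] at hL
      exact hL.trans (hlmax (x - 1) hbx (by omega) rfl h0)
  have hme : m ≤ eIdx LCP n x := by
    by_contra! hcon
    have hLe : LCP (eIdx LCP n x) < w l := by
      rcases he with he | he
      · omega
      · rcases hm with hm | hm <;> omega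
    rcases hm with ⟨-, -, -, hm⟩ | ⟨hmn, hm⟩
    · exact hm _ hle hcon hLe
    · exact hm _ hle (by omega) hLe
  have hLm : ∀ y, l < y → y < m → w l ≤ LCP y := by
    intro y hly hym
    rcases hm with ⟨-, -, -, hm⟩ | ⟨-, hm⟩
    · exact not_lt.1 (hm y hly hym)
    · exact not_lt.1 (hm y hly (by omega))
  refine ⟨⟨by omega, hme⟩, fun j hlj hjm hjc hj0 => ?_⟩
  have hjw := hlmax j (by omega) (by omega) hjc hj0
  refine ⟨hjw, fun l' hl' hj => ?_⟩
  have hLl' : LCP l' ≤ w j := by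
    split_ifs at hl' with heq
    · rw [hl', heq]
    · subst hl'
      by_cases hjn : j = n
      · rw [hjn, hsetup.hLCPend, ← hjn]
        omega
      · have hjb : RunBoundary BWT n j := by
          by_contra hnb
          have := hsetup.hwNot j (by omega) (by omega) hnb
          omega
        rcases hjb with ⟨h₁, h₂⟩ | ⟨h₁, h₂⟩
        · have := hsetup.weight_of_startRun h₁ (by omega) h₂
          have := hLm j hlj hjm
          omega
        · exact (hsetup.weight_of_endRun (by omega) (by omega) h₂).2
  have hbl' : bIdx LCP l' ≤ l := by
    refine bIdx_le (by omega) fun y hly hyl' => ?_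
    have hyj : y ≤ j := by split_ifs at hl' <;> omega
    have := hLm y hly (by omega)
    omega
  obtain ⟨-, -, -, -, hfirst⟩ := Candt_spec hj
  rcases hfirst l hbl' hlj hlc with h | h <;> omega
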